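/- arXiv:2105.15127 — 6 statements merged into one kernel-verified Lean document; each statement's English description precedes it below -/
import Mathlib

section
/- Let A ≥ 3 be an integer and let C₁, C₂ be nonzero integers with X = max(|C₁|, |C₂|). If C₁ x_{n₁} + C₂ x_{n₂} = 0 with n₁ > n₂ ≥ 1, then A ≤ X and n₁ ≤ 2 + 2·log X/log ψ, where ψ = (3 + √5)/2. -/
/-- The balancing-like sequence: `x 0 = 0`, `x 1 = 1`, `x (n+2) = A * x (n+1) - x n`. -/
def balLike (A : ℤ) : ℕ → ℤ
  | 0 => 0
  | 1 => 1
  | n + 2 => A * balLike A (n + 1) - balLike A n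

theorem balLike_add_two (A : ℤ) (n : ℕ) :
    balLike A (n + 2) = A * balLike A (n + 1) - balLike A n := rfl

theorem balLike_add_succ (A : ℤ) (m n : ℕ) :
    balLike A (m + n + 1) = balLike A (m + 1) * balLike A (n + 1) - balLike A m * balLike A n := by
  induction m generalizing n with
  | zero => simp [balLike]
  | succ m ih =>
    rw [show m + 1 + n + 1 = m + (n + 1) + 1 by ring, ih (n + 1), balLike_add_two A m,
      balLike_add_two A n]
    ring

theorem balLike_succ_sq (A : ℤ) (n : ℕ) :
    balLike A (n + 1) ^ 2 - A * balLike A n * balLike A (n + 1) + balLike A n ^ 2 = 1 := by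
  induction n with
  | zero => simp [balLike]
  | succ n ih =>
    rw [balLike_add_two]
    linear_combination ih

theorem dvd_mul_balLike_of_add {A g C : ℤ} {m n : ℕ} (hm : g ∣ C * balLike A m)
    (hmn : g ∣ C * balLike A (m + n)) : g ∣ C * balLike A n := by
  cases n with
  | zero => simp [balLike]
  | succ n =>
    obtain ⟨a, ha⟩ := hm
    obtain ⟨b, hb⟩ := hmn
    rw [← add_assoc, balLike_add_succ] at hb
    have h := balLike_succ_sq A m
    refine ⟨(b + a * balLike A n) * (balLike A (m + 1) - A * balLike A m)
      + a * balLike A m * balLike A (n + 1), ?_⟩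
    linear_combination (-C * balLike A (n + 1)) * h
      + (balLike A (m + 1) - A * balLike A m) * hb
      + (balLike A n * (balLike A (m + 1) - A * balLike A m)
        + balLike A m * balLike A (n + 1)) * ha

theorem dvd_mul_balLike_mod {A g C : ℤ} {m n : ℕ} (hm : g ∣ C * balLike A m)
    (hn : g ∣ C * balLike A n) : g ∣ C * balLike A (n % m) := by
  induction n using Nat.strong_induction_on with
  | _ n ih =>
    rcases lt_or_ge n m with h | h
    · rwa [Nat.mod_eq_of_lt h]
    · rcases Nat.eq_zero_or_pos m with rfl | hpos
      · simpa using hn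
      · rw [Nat.mod_eq_sub_mod h]
        refine ih (n - m) (by omega) (dvd_mul_balLike_of_add hm ?_)
        rwa [Nat.add_sub_cancel' h]

theorem dvd_mul_balLike_gcd {A g C : ℤ} (m n : ℕ) (hm : g ∣ C * balLike A m)
    (hn : g ∣ C * balLike A n) : g ∣ C * balLike A (m.gcd n) := by
  induction m, n using Nat.gcd.induction with
  | H0 n => simpa using hn
  | H1 m n _ ih =>
    rw [Nat.gcd_rec]
    exact ih (dvd_mul_balLike_mod hm hn) hm

theorem balLike_nonneg_and_two_mul_le {A : ℤ} (hA : 3 ≤ A) (n : ℕ) :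
    0 ≤ balLike A n ∧ 2 * balLike A n ≤ balLike A (n + 1) := by
  induction n with
  | zero => simp [balLike]
  | succ n ih =>
    rw [balLike_add_two]
    constructor <;> nlinarith [ih.1, ih.2]

theorem balLike_pos {A : ℤ} (hA : 3 ≤ A) {n : ℕ} (hn : 1 ≤ n) : 0 < balLike A n := by
  induction n, hn using Nat.le_induction with
  | base => simp [balLike]
  | succ n _ ih => linarith [(balLike_nonneg_and_two_mul_le hA n).2]

theorem balLike_monotone {A : ℤ} (hA : 3 ≤ A) : Monotone (balLike A) :=
  monotone_nat_of_le_succ fun n => by linarith [balLike_nonneg_and_two_mul_le hA n]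

theorem mul_balLike_le {A : ℤ} (hA : 3 ≤ A) {d n : ℕ} (hn : d + 2 ≤ n) :
    A * balLike A d ≤ balLike A n := by
  refine le_trans ?_ (balLike_monotone hA hn)
  rw [balLike_add_two]
  obtain ⟨h0, h2⟩ := balLike_nonneg_and_two_mul_le hA d
  nlinarith

theorem mul_balLike_le_succ {A : ℤ} (hA : 3 ≤ A) {ψ : ℝ} (hψ0 : 0 < ψ) (hψ : ψ ^ 2 = 3 * ψ - 1)
    (n : ℕ) : ψ * balLike A n ≤ balLike A (n + 1) := by
  induction n with
  | zero => simp [balLike]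
  | succ n ih =>
    have hA' : (3 : ℝ) ≤ A := by exact_mod_cast hA
    have hx : (0 : ℝ) ≤ balLike A (n + 1) := by
      exact_mod_cast (balLike_nonneg_and_two_mul_le hA (n + 1)).1
    rw [balLike_add_two]
    push_cast
    refine le_of_mul_le_mul_left ?_ hψ0
    nlinarith [mul_nonneg hψ0.le (mul_nonneg (sub_nonneg.2 hA') hx)]

theorem pow_mul_balLike_le {A : ℤ} (hA : 3 ≤ A) {ψ : ℝ} (hψ0 : 0 < ψ) (hψ : ψ ^ 2 = 3 * ψ - 1)
    (d k : ℕ) : ψ ^ k * balLike A d ≤ balLike A (d + k) := by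
  induction k with
  | zero => simp
  | succ k ih =>
    calc ψ ^ (k + 1) * balLike A d = ψ * (ψ ^ k * balLike A d) := by ring
      _ ≤ ψ * balLike A (d + k) := by gcongr
      _ ≤ balLike A (d + k + 1) := mul_balLike_le_succ hA hψ0 hψ _

theorem two_term_bound (A : ℤ) (hA : 3 ≤ A) (C₁ C₂ : ℤ) (hC₁ : C₁ ≠ 0) (hC₂ : C₂ ≠ 0)
    (X : ℤ) (hX : X = max |C₁| |C₂|)
    (n₁ n₂ : ℕ) (h12 : n₁ > n₂) (hn₂ : 1 ≤ n₂)
    (heq : C₁ * balLike A n₁ + C₂ * balLike A n₂ = 0)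
    (ψ : ℝ) (hψ : ψ = (3 + Real.sqrt 5) / 2) :
    A ≤ X ∧ (n₁ : ℝ) ≤ 2 + 2 * Real.log (X : ℝ) / Real.log ψ := by
  have hdvd : balLike A n₁ ∣ C₂ * balLike A (n₁.gcd n₂) :=
    dvd_mul_balLike_gcd n₁ n₂ (dvd_mul_left _ _) ⟨-C₁, by linear_combination heq⟩
  obtain ⟨q, hq⟩ := Nat.gcd_dvd_left n₁ n₂
  have hd1 : 1 ≤ n₁.gcd n₂ := Nat.gcd_pos_of_pos_right _ hn₂
  have hdn : n₁.gcd n₂ ≤ n₂ := Nat.gcd_le_right _ hn₂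
  generalize n₁.gcd n₂ = d at *
  have h2d : 2 * d ≤ n₁ := by
    have : 2 ≤ q := by
      by_contra! h
      interval_cases q <;> omega
    nlinarith
  have hxd := balLike_pos hA hd1
  have hle : balLike A n₁ ≤ X * balLike A d := by
    have h := Int.le_of_dvd (by positivity) ((dvd_abs _ _).2 hdvd)
    rw [abs_mul, abs_of_pos hxd] at h
    exact h.trans (mul_le_mul_of_nonneg_right (hX ▸ le_max_right _ _) hxd.le)
  have hAX : A ≤ X := by
    refine le_of_mul_le_mul_right (le_trans ?_ hle) hxd
    rcases le_or_gt (d + 2) n₁ with h | h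
    · exact mul_balLike_le hA h
    · obtain rfl : d = 1 := by omega
      obtain rfl : n₁ = 2 := by omega
      simp [balLike]
  refine ⟨hAX, ?_⟩
  have h5 : Real.sqrt 5 ^ 2 = 5 := Real.sq_sqrt (by norm_num)
  have hψ1 : 1 < ψ := by linarith [Real.sqrt_nonneg 5]
  have hψ2 : ψ ^ 2 = 3 * ψ - 1 := by
    rw [hψ]
    linear_combination h5 / 4
  have hlog : 0 < Real.log ψ := Real.log_pos hψ1
  have hpow : ψ ^ (n₁ - d) ≤ X := by
    have h := pow_mul_balLike_le hA (by linarith) hψ2 d (n₁ - d)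
    rw [Nat.add_sub_cancel' (by omega)] at h
    have hle' : (balLike A n₁ : ℝ) ≤ X * balLike A d := by exact_mod_cast hle
    exact le_of_mul_le_mul_right (h.trans hle') (by exact_mod_cast hxd)
  have hlogX : ((n₁ - d : ℕ) : ℝ) * Real.log ψ ≤ Real.log X := by
    rw [← Real.log_pow]
    exact Real.log_le_log (by positivity) hpow
  have hn : (n₁ : ℝ) ≤ 2 * ((n₁ - d : ℕ) : ℝ) := by exact_mod_cast (by omega : n₁ ≤ 2 * (n₁ - d))
  have hdiv := (le_div_iff₀ hlog).2 hlogX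
  rw [mul_div_assoc]
  linarith
end

section
/- Let A ≥ 3 be an integer and let A₁, A₂, A₃, A₄, A₅ be integers with A₁ ≠ 0 and |A_i| ≤ X for all i, where X ≥ 1. If A₁ x_{m₁} + A₂ x_{m₂} + A₃ x_{m₃} + A₄ x_{m₄} + A₅ x_{m₅} = 0 with m₁ > m₂ ≥ m₃ ≥ m₄ ≥ m₅ ≥ 0, then γ^{m₁ − m₂} < 9X, where γ = (A + √(A²−4))/2. -/
theorem mul_balLike_le_balLike_succ {A : ℤ} {γ δ : ℝ} (hδ : 0 ≤ δ) (hsum : γ + δ = A)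
    (hprod : γ * δ = 1) (n : ℕ) : γ * balLike A n ≤ balLike A (n + 1) := by
  induction n with
  | zero => simp [balLike]
  | succ n ih =>
    have hrec : (balLike A (n + 2) : ℝ) - γ * balLike A (n + 1) =
        δ * (balLike A (n + 1) - γ * balLike A n) := by
      simp only [balLike]
      push_cast
      rw [← hsum]
      linear_combination (balLike A n : ℝ) * hprod
    have := mul_nonneg hδ (sub_nonneg.2 ih)
    linarith

theorem balLike_nonneg {A : ℤ} {γ δ : ℝ} (hγ : 0 ≤ γ) (hδ : 0 ≤ δ) (hsum : γ + δ = A)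
    (hprod : γ * δ = 1) (n : ℕ) : (0 : ℝ) ≤ balLike A n := by
  induction n with
  | zero => simp [balLike]
  | succ n ih =>
    exact (mul_nonneg hγ ih).trans (mul_balLike_le_balLike_succ hδ hsum hprod n)

theorem pow_mul_balLike_le_balLike_add {A : ℤ} {γ δ : ℝ} (hγ : 0 ≤ γ) (hδ : 0 ≤ δ)
    (hsum : γ + δ = A) (hprod : γ * δ = 1) (m k : ℕ) :
    γ ^ k * balLike A m ≤ balLike A (m + k) := by
  induction k with
  | zero => simp
  | succ k ih =>
    calc γ ^ (k + 1) * balLike A m = γ * (γ ^ k * balLike A m) := by ring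
      _ ≤ γ * balLike A (m + k) := by gcongr
      _ ≤ balLike A (m + (k + 1)) := mul_balLike_le_balLike_succ hδ hsum hprod (m + k)

theorem one_le_balLike_succ {A : ℤ} {γ δ : ℝ} (hγ : 1 ≤ γ) (hδ : 0 ≤ δ)
    (hsum : γ + δ = A) (hprod : γ * δ = 1) (n : ℕ) : (1 : ℝ) ≤ balLike A (n + 1) := by
  have h := pow_mul_balLike_le_balLike_add (zero_le_one.trans hγ) hδ hsum hprod 1 n
  rw [add_comm 1 n] at h
  simp only [balLike, Int.cast_one, mul_one] at h
  exact (one_le_pow₀ hγ).trans h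

theorem balLike_monotone_s8 {A : ℤ} {γ δ : ℝ} (hγ : 1 ≤ γ) (hδ : 0 ≤ δ)
    (hsum : γ + δ = A) (hprod : γ * δ = 1) : Monotone (balLike A) := by
  refine monotone_nat_of_le_succ fun n => ?_
  have h := mul_balLike_le_balLike_succ hδ hsum hprod n
  have h' := le_mul_of_one_le_left (balLike_nonneg (zero_le_one.trans hγ) hδ hsum hprod n) hγ
  exact_mod_cast h'.trans h

theorem five_term_gap_bound (A : ℤ) (hA : 3 ≤ A) (A₁ A₂ A₃ A₄ A₅ X : ℤ)
    (hA₁ : A₁ ≠ 0) (hX : 1 ≤ X)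
    (h1 : |A₁| ≤ X) (h2 : |A₂| ≤ X) (h3 : |A₃| ≤ X) (h4 : |A₄| ≤ X) (h5 : |A₅| ≤ X)
    (m₁ m₂ m₃ m₄ m₅ : ℕ) (h12 : m₁ > m₂) (h23 : m₂ ≥ m₃) (h34 : m₃ ≥ m₄) (h45 : m₄ ≥ m₅)
    (heq : A₁ * balLike A m₁ + A₂ * balLike A m₂ + A₃ * balLike A m₃ +
      A₄ * balLike A m₄ + A₅ * balLike A m₅ = 0)
    (γ : ℝ) (hγ : γ = ((A : ℝ) + Real.sqrt ((A : ℝ) ^ 2 - 4)) / 2) :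
    γ ^ (m₁ - m₂) < 9 * (X : ℝ) := by
  obtain ⟨δ, hδ, hsum, hprod, hγ1⟩ :
      ∃ δ : ℝ, 0 ≤ δ ∧ γ + δ = A ∧ γ * δ = 1 ∧ 1 ≤ γ := by
    have hA' : (3 : ℝ) ≤ A := by exact_mod_cast hA
    have hsq := Real.sq_sqrt (show (0 : ℝ) ≤ (A : ℝ) ^ 2 - 4 by nlinarith)
    have hle : Real.sqrt ((A : ℝ) ^ 2 - 4) ≤ A :=
      Real.sqrt_le_iff.2 ⟨by linarith, by linarith⟩
    have hnn := Real.sqrt_nonneg ((A : ℝ) ^ 2 - 4)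
    refine ⟨((A : ℝ) - Real.sqrt ((A : ℝ) ^ 2 - 4)) / 2, by linarith, by rw [hγ]; ring, ?_,
      by linarith⟩
    rw [hγ]
    linear_combination (-1 / 4 : ℝ) * hsq
  have hγ0 : 0 ≤ γ := zero_le_one.trans hγ1
  have hmono := balLike_monotone_s8 hγ1 hδ hsum hprod
  have hnonneg : ∀ n, 0 ≤ balLike A n := fun n => by
    exact_mod_cast balLike_nonneg hγ0 hδ hsum hprod n
  have hterm : ∀ (B : ℤ) (m : ℕ), |B| ≤ X → m ≤ m₂ →
      -(B * balLike A m) ≤ X * balLike A m₂ ∧ B * balLike A m ≤ X * balLike A m₂ := by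
    intro B m hB hm
    have h : |B * balLike A m| ≤ X * balLike A m₂ := by
      rw [abs_mul, abs_of_nonneg (hnonneg m)]
      exact mul_le_mul hB (hmono hm) (hnonneg m) (by linarith)
    exact ⟨(neg_le_abs _).trans h, (le_abs_self _).trans h⟩
  have hlead : balLike A m₁ ≤ 4 * X * balLike A m₂ := by
    have hone : 1 * balLike A m₁ ≤ |A₁| * balLike A m₁ :=
      mul_le_mul_of_nonneg_right (Int.one_le_abs hA₁) (hnonneg m₁)
    have habs : |A₁ * balLike A m₁| ≤ 4 * X * balLike A m₂ := by
      have t2 := hterm A₂ m₂ h2 le_rfl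
      have t3 := hterm A₃ m₃ h3 h23
      have t4 := hterm A₄ m₄ h4 (h34.trans h23)
      have t5 := hterm A₅ m₅ h5 (h45.trans (h34.trans h23))
      rw [abs_le]
      constructor <;> linarith
    rw [abs_mul, abs_of_nonneg (hnonneg m₁)] at habs
    linarith
  have hpos₁ : 0 < balLike A m₁ := by
    obtain ⟨k, rfl⟩ : ∃ k, m₁ = k + 1 := ⟨m₁ - 1, by omega⟩
    have h : 1 ≤ balLike A (k + 1) := by
      exact_mod_cast one_le_balLike_succ hγ1 hδ hsum hprod k
    linarith
  have hpos₂ : 0 < balLike A m₂ := by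
    refine (hnonneg m₂).lt_of_ne fun h => ?_
    rw [← h] at hlead
    linarith
  have hpow := pow_mul_balLike_le_balLike_add hγ0 hδ hsum hprod m₂ (m₁ - m₂)
  rw [Nat.add_sub_of_le h12.le] at hpow
  have hlead' : (balLike A m₁ : ℝ) ≤ 4 * X * balLike A m₂ := by exact_mod_cast hlead
  have hle : γ ^ (m₁ - m₂) ≤ 4 * (X : ℝ) :=
    le_of_mul_le_mul_right (hpow.trans hlead') (by exact_mod_cast hpos₂)
  have hX' : (1 : ℝ) ≤ X := by exact_mod_cast hX
  linarith
end

section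
/- Let A ≥ 3 be an integer and let A₁, A₂, A₃, A₄, A₅, A₆ be integers with A₁ ≠ 0 and |A_i| ≤ X for all i, where X ≥ 1. If A₁ x_{m₁} + A₂ x_{m₂} + A₃ x_{m₃} + A₄ x_{m₄} + A₅ x_{m₅} + A₆ x_{m₆} = 0 with m₁ > m₂ ≥ m₃ ≥ m₄ ≥ m₅ ≥ m₆ ≥ 0, then γ^{m₁ − m₂} < 11X, where γ = (A + √(A²−4))/2; in particular A < 11X. -/
theorem balLike_succ_eq {A : ℤ} {γ δ : ℝ} (hsum : γ + δ = A) (hprod : γ * δ = 1) (n : ℕ) :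
    (balLike A (n + 1) : ℝ) = γ * balLike A n + δ ^ n := by
  induction n with
  | zero => simp [balLike]
  | succ n ih =>
    have hrec : (balLike A (n + 2) : ℝ) = A * balLike A (n + 1) - balLike A n := by
      simp [balLike]
    rw [hrec, pow_succ, ← hsum]
    linear_combination δ * ih + (balLike A n : ℝ) * hprod

theorem balLike_nonneg_of_roots {A : ℤ} {γ δ : ℝ} (hsum : γ + δ = A) (hprod : γ * δ = 1)
    (hγ : 0 ≤ γ) (hδ : 0 ≤ δ) (n : ℕ) : (0 : ℝ) ≤ balLike A n := by
  induction n with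
  | zero => simp [balLike]
  | succ n ih =>
    rw [balLike_succ_eq hsum hprod]
    positivity

theorem balLike_pos_of_roots {A : ℤ} {γ δ : ℝ} (hsum : γ + δ = A) (hprod : γ * δ = 1)
    (hγ : 0 ≤ γ) (hδ : 0 < δ) {n : ℕ} (hn : n ≠ 0) : (0 : ℝ) < balLike A n := by
  obtain ⟨k, rfl⟩ := Nat.exists_eq_succ_of_ne_zero hn
  have hk := balLike_nonneg_of_roots hsum hprod hγ hδ.le k
  rw [Nat.succ_eq_add_one, balLike_succ_eq hsum hprod]
  positivity

theorem pow_mul_balLike_le_s9 {A : ℤ} {γ δ : ℝ} (hsum : γ + δ = A) (hprod : γ * δ = 1)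
    (hγ : 0 ≤ γ) (hδ : 0 ≤ δ) (m k : ℕ) :
    γ ^ k * balLike A m ≤ (balLike A (m + k) : ℝ) := by
  induction k with
  | zero => simp
  | succ k ih =>
    rw [← add_assoc, balLike_succ_eq hsum hprod, pow_succ']
    have hstep := mul_le_mul_of_nonneg_left ih hγ
    have hpow : 0 ≤ δ ^ (m + k) := by positivity
    linarith

theorem balLike_monotone_of_roots {A : ℤ} {γ δ : ℝ} (hsum : γ + δ = A) (hprod : γ * δ = 1)
    (hγ : 1 ≤ γ) (hδ : 0 ≤ δ) : Monotone (fun n => (balLike A n : ℝ)) := by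
  refine monotone_nat_of_le_succ fun n => ?_
  have hn := balLike_nonneg_of_roots hsum hprod (by linarith) hδ n
  have hpow : 0 ≤ δ ^ n := by positivity
  rw [balLike_succ_eq hsum hprod]
  nlinarith

theorem six_term_gap_bound (A : ℤ) (hA : 3 ≤ A) (A₁ A₂ A₃ A₄ A₅ A₆ X : ℤ)
    (hA₁ : A₁ ≠ 0) (hX : 1 ≤ X)
    (h1 : |A₁| ≤ X) (h2 : |A₂| ≤ X) (h3 : |A₃| ≤ X) (h4 : |A₄| ≤ X)
    (h5 : |A₅| ≤ X) (h6 : |A₆| ≤ X)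
    (m₁ m₂ m₃ m₄ m₅ m₆ : ℕ) (h12 : m₁ > m₂) (h23 : m₂ ≥ m₃) (h34 : m₃ ≥ m₄)
    (h45 : m₄ ≥ m₅) (h56 : m₅ ≥ m₆)
    (heq : A₁ * balLike A m₁ + A₂ * balLike A m₂ + A₃ * balLike A m₃ +
      A₄ * balLike A m₄ + A₅ * balLike A m₅ + A₆ * balLike A m₆ = 0)
    (γ : ℝ) (hγ : γ = ((A : ℝ) + Real.sqrt ((A : ℝ) ^ 2 - 4)) / 2) :
    γ ^ (m₁ - m₂) < 11 * (X : ℝ) ∧ (A : ℝ) < 11 * (X : ℝ) := by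
  have hA' : (3 : ℝ) ≤ A := by exact_mod_cast hA
  have hX' : (1 : ℝ) ≤ X := by exact_mod_cast hX
  have hsq : Real.sqrt ((A : ℝ) ^ 2 - 4) ^ 2 = (A : ℝ) ^ 2 - 4 :=
    Real.sq_sqrt (by nlinarith)
  have hs0 : 0 ≤ Real.sqrt ((A : ℝ) ^ 2 - 4) := Real.sqrt_nonneg _
  obtain ⟨δ, hδ⟩ : ∃ δ : ℝ, δ = A - γ := ⟨_, rfl⟩
  have hsum : γ + δ = A := by rw [hδ]; ring
  have hprod : γ * δ = 1 := by
    rw [hδ, hγ]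
    linear_combination -hsq / 4
  have hγ1 : 1 ≤ γ := by rw [hγ]; linarith
  have hγ0 : 0 ≤ γ := by linarith
  have hδ0 : 0 < δ := by
    by_contra! h
    nlinarith
  have hδ1 : δ ≤ 1 := by nlinarith
  have hmono := balLike_monotone_of_roots hsum hprod hγ1 hδ0.le
  have hterm : ∀ (B : ℤ) (m : ℕ), |B| ≤ X → m ≤ m₂ →
      -((X : ℝ) * balLike A m₂) ≤ B * balLike A m := by
    intro B m hB hm
    have hB' : -(X : ℝ) ≤ B := by exact_mod_cast (abs_le.mp hB).1
    have hm0 := balLike_nonneg_of_roots hsum hprod hγ0 hδ0.le m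
    have hle : (balLike A m : ℝ) ≤ balLike A m₂ := hmono hm
    nlinarith
  have hterm_abs : ∀ (B : ℤ) (m : ℕ), |B| ≤ X → m ≤ m₂ →
      |(B : ℝ) * balLike A m| ≤ X * balLike A m₂ := by
    intro B m hB hm
    have hneg := hterm (-B) m (by rwa [abs_neg]) hm
    push_cast at hneg
    exact abs_le.mpr ⟨hterm B m hB hm, by linarith⟩
  have heq' : (A₁ : ℝ) * balLike A m₁ + A₂ * balLike A m₂ + A₃ * balLike A m₃ +
      A₄ * balLike A m₄ + A₅ * balLike A m₅ + A₆ * balLike A m₆ = 0 := by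
    exact_mod_cast heq
  have hx₁ : (0 : ℝ) < balLike A m₁ :=
    balLike_pos_of_roots hsum hprod hγ0 hδ0 (by omega)
  have hlead : (balLike A m₁ : ℝ) ≤ |(A₁ : ℝ) * balLike A m₁| := by
    have hone : (1 : ℝ) ≤ |(A₁ : ℝ)| := by exact_mod_cast Int.one_le_abs hA₁
    rw [abs_mul, abs_of_pos hx₁]
    nlinarith
  have hupper : (balLike A m₁ : ℝ) ≤ 5 * X * balLike A m₂ := by
    have b2 := abs_le.mp (hterm_abs A₂ m₂ h2 le_rfl)
    have b3 := abs_le.mp (hterm_abs A₃ m₃ h3 (by omega))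
    have b4 := abs_le.mp (hterm_abs A₄ m₄ h4 (by omega))
    have b5 := abs_le.mp (hterm_abs A₅ m₅ h5 (by omega))
    have b6 := abs_le.mp (hterm_abs A₆ m₆ h6 (by omega))
    refine hlead.trans (abs_le.mpr ⟨?_, ?_⟩) <;> linarith
  have hx₂ : (0 : ℝ) < balLike A m₂ := by
    by_contra! h
    nlinarith
  have hgap : γ ^ (m₁ - m₂) ≤ 5 * X := by
    have hgrow := pow_mul_balLike_le_s9 hsum hprod hγ0 hδ0.le m₂ (m₁ - m₂)
    rw [Nat.add_sub_cancel' h12.le] at hgrow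
    exact le_of_mul_le_mul_right (hgrow.trans hupper) hx₂
  have hself : γ ≤ γ ^ (m₁ - m₂) := le_self_pow₀ hγ1 (by omega)
  constructor <;> linarith
end

section
/- Let A ≥ 3 be an integer, γ = (A + √(A²−4))/2. Let A₁, …, A₆ be integers and m > l > k > j > i > 0 natural numbers such that A₁γ^m + A₂γ^l + A₃γ^k + A₄γ^j + A₅γ^i + A₆ = 0. Then for every natural number n, A₁ x_{n+m} + A₂ x_{n+l} + A₃ x_{n+k} + A₄ x_{n+j} + A₅ x_{n+i} + A₆ x_n = 0; i.e., (m₁, …, m₆) = (n + m, n + l, n + k, n + j, n + i, n) is a parametric family of solutions. -/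
/-- Powers of a root of `X ^ 2 - A * X + 1` in terms of the balancing-like sequence. -/
lemma pow_succ_eq_balLike (A : ℤ) {R : Type*} [CommRing R] {γ : R}
    (hγ : γ ^ 2 = A * γ - 1) (n : ℕ) :
    γ ^ (n + 1) = balLike A (n + 1) * γ - balLike A n := by
  induction n with
  | zero => simp [balLike]
  | succ n ih =>
    rw [pow_succ, ih, balLike]
    push_cast
    linear_combination (balLike A (n + 1) : R) * hγ

lemma irrational_sqrt_sq_sub_four {A : ℤ} (hA : 3 ≤ A) :
    Irrational √((A : ℝ) ^ 2 - 4) := by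
  have h : Irrational √((A ^ 2 - 4 : ℤ) : ℝ) := by
    rw [irrational_sqrt_intCast_iff]
    refine ⟨?_, by nlinarith⟩
    rintro ⟨r, hr⟩
    have hr' : |r| * |r| = A ^ 2 - 4 := by rw [abs_mul_abs_self, hr]
    have hlt : |r| < A := by nlinarith [abs_nonneg r]
    nlinarith [abs_nonneg r]
  exact_mod_cast h

theorem parametric_family_six (A : ℤ) (hA : 3 ≤ A) (γ : ℝ)
    (hγ : γ = ((A : ℝ) + Real.sqrt ((A : ℝ) ^ 2 - 4)) / 2)
    (A₁ A₂ A₃ A₄ A₅ A₆ : ℤ) (i j k l m : ℕ)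
    (hml : m > l) (hlk : l > k) (hkj : k > j) (hji : j > i) (hi : i > 0)
    (hroot : (A₁ : ℝ) * γ ^ m + (A₂ : ℝ) * γ ^ l + (A₃ : ℝ) * γ ^ k +
      (A₄ : ℝ) * γ ^ j + (A₅ : ℝ) * γ ^ i + (A₆ : ℝ) = 0) :
    ∀ n : ℕ, A₁ * balLike A (n + m) + A₂ * balLike A (n + l) + A₃ * balLike A (n + k) +
      A₄ * balLike A (n + j) + A₅ * balLike A (n + i) + A₆ * balLike A n = 0 := by
  intro n
  have hγ_irr : Irrational γ := by
    rw [hγ]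
    exact_mod_cast ((irrational_sqrt_sq_sub_four hA).intCast_add A).div_natCast
      (two_ne_zero : (2 : ℕ) ≠ 0)
  have hγ_sq : γ ^ 2 = A * γ - 1 := by
    have hA' : (3 : ℝ) ≤ A := by exact_mod_cast hA
    have hs := Real.sq_sqrt (show (0 : ℝ) ≤ (A : ℝ) ^ 2 - 4 by nlinarith)
    rw [hγ]
    linear_combination hs / 4
  set S : ℕ → ℤ := fun n ↦ A₁ * balLike A (n + m) + A₂ * balLike A (n + l) +
    A₃ * balLike A (n + k) + A₄ * balLike A (n + j) + A₅ * balLike A (n + i) +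
    A₆ * balLike A n with hS
  have hlin : (S (n + 1) : ℝ) * γ - S n = 0 := by
    have hpow := pow_succ_eq_balLike A hγ_sq
    simp only [hS, add_right_comm n 1]
    push_cast
    linear_combination γ ^ (n + 1) * hroot - A₁ * hpow (n + m) - A₂ * hpow (n + l) -
      A₃ * hpow (n + k) - A₄ * hpow (n + j) - A₅ * hpow (n + i) - A₆ * hpow n
  have hzero : S (n + 1) = 0 := by
    by_contra hne
    exact (hγ_irr.intCast_mul hne).ne_int (S n) (sub_eq_zero.mp hlin)
  change S n = 0
  simpa [hzero] using hlin
end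

section
/- Let A ≥ 3 be an integer, γ = (A + √(A²−4))/2, and let A₁, …, A₆ be integers with |A_i| ≤ X for all i, X ≥ 1. Suppose A₁ x_{m₁} + A₂ x_{m₂} + A₃ x_{m₃} + A₄ x_{m₄} + A₅ x_{m₅} + A₆ x_{m₆} = 0 with m₁ ≥ m₂ ≥ m₃ ≥ m₄ ≥ m₅ ≥ m₆ ≥ 0, and that A₁γ^{m₁−m₅} + A₂γ^{m₂−m₅} + A₃γ^{m₃−m₅} + A₄γ^{m₄−m₅} + A₅ ≠ 0. Then either γ^{m₅} < 8X, or γ^{m₅ − m₆} ≤ 20X² (so m₅ − m₆ ≤ log(20X²)/log ψ, where ψ = (3 + √5)/2). -/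
/-- Binet's formula for the balancing-like sequence. -/
theorem balLike_mul_sub (A : ℤ) {γ δ : ℝ} (hsum : γ + δ = A) (hmul : γ * δ = 1) (n : ℕ) :
    (balLike A n : ℝ) * (γ - δ) = γ ^ n - δ ^ n := by
  induction n using Nat.twoStepInduction with
  | zero => simp [balLike]
  | one => simp [balLike]
  | more n ih₀ ih₁ =>
    rw [balLike]
    push_cast
    rw [← hsum]
    linear_combination (γ + δ) * ih₁ - ih₀ + (γ ^ n - δ ^ n) * hmul

/-- Powers of the two roots of `t ^ 2 - A t + 1` have the same coordinates in the bases
`1, γ` and `1, δ`. -/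
theorem exists_pow_eq_add_mul (A : ℤ) {γ δ : ℝ} (hsum : γ + δ = A) (hmul : γ * δ = 1) (n : ℕ) :
    ∃ u v : ℤ, γ ^ n = u + v * γ ∧ δ ^ n = u + v * δ := by
  induction n with
  | zero => exact ⟨1, 0, by simp, by simp⟩
  | succ n ih =>
    obtain ⟨u, v, hu, hv⟩ := ih
    refine ⟨-v, u + A * v, ?_, ?_⟩
    · push_cast
      rw [pow_succ, hu, ← hsum]
      linear_combination -v * hmul
    · push_cast
      rw [pow_succ, hv, ← hsum]
      linear_combination -v * hmul

theorem eq_zero_of_sq_add_mul_add_sq_eq_zero {A a b : ℤ} (hA : 3 ≤ A)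
    (h : a ^ 2 + A * a * b + b ^ 2 = 0) : a = 0 ∧ b = 0 := by
  have hsq : (2 * a + A * b) ^ 2 = (A ^ 2 - 4) * b ^ 2 := by linear_combination 4 * h
  have hb : b = 0 := by
    by_contra hb
    obtain ⟨k, hk⟩ : b ∣ 2 * a + A * b :=
      (Int.pow_dvd_pow_iff two_ne_zero).1 ⟨A ^ 2 - 4, by rw [hsq]; ring⟩
    have hkA : k ^ 2 = A ^ 2 - 4 := by
      apply mul_right_cancel₀ (pow_ne_zero 2 hb)
      rw [← hsq, hk]
      ring
    have h₁ : |k| < A := abs_lt_of_sq_lt_sq (by linarith) (by linarith)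
    have h₂ : A - 1 < |k| := by
      apply lt_of_pow_lt_pow_left₀ 2 (abs_nonneg k)
      rw [sq_abs]
      nlinarith
    omega
  subst hb
  simpa using h

/-- A nonzero element of `ℤ[γ]` has norm at least one in absolute value. -/
theorem one_le_abs_mul_conj {A : ℤ} (hA : 3 ≤ A) {γ δ : ℝ} (hsum : γ + δ = A)
    (hmul : γ * δ = 1) (a b : ℤ) (hne : (a : ℝ) + b * γ ≠ 0) :
    1 ≤ |(a : ℝ) + b * γ| * |(a : ℝ) + b * δ| := by
  have hnorm : ((a : ℝ) + b * γ) * (a + b * δ) = ((a ^ 2 + A * a * b + b ^ 2 : ℤ) : ℝ) := by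
    push_cast
    rw [← hsum]
    linear_combination (b : ℝ) ^ 2 * hmul
  rw [← abs_mul, hnorm, ← Int.cast_abs]
  refine mod_cast Int.one_le_abs fun h => hne ?_
  obtain ⟨rfl, rfl⟩ := eq_zero_of_sq_add_mul_add_sq_eq_zero hA h
  simp

theorem abs_mul_le_of_abs_le_one {a b c : ℝ} (ha : |a| ≤ c) (hb₀ : 0 ≤ b) (hb₁ : b ≤ 1) :
    |a * b| ≤ c := by
  rw [abs_mul, abs_of_nonneg hb₀]
  exact (mul_le_of_le_one_right (abs_nonneg a) hb₁).trans ha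

theorem bound_m5_m6 (A : ℤ) (hA : 3 ≤ A) (γ ψ : ℝ)
    (hγ : γ = ((A : ℝ) + Real.sqrt ((A : ℝ) ^ 2 - 4)) / 2)
    (hψ : ψ = (3 + Real.sqrt 5) / 2)
    (A₁ A₂ A₃ A₄ A₅ A₆ X : ℤ) (hX : 1 ≤ X)
    (h1 : |A₁| ≤ X) (h2 : |A₂| ≤ X) (h3 : |A₃| ≤ X) (h4 : |A₄| ≤ X)
    (h5 : |A₅| ≤ X) (h6 : |A₆| ≤ X)
    (m₁ m₂ m₃ m₄ m₅ m₆ : ℕ) (h12 : m₁ ≥ m₂) (h23 : m₂ ≥ m₃) (h34 : m₃ ≥ m₄)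
    (h45 : m₄ ≥ m₅) (h56 : m₅ ≥ m₆)
    (heq : A₁ * balLike A m₁ + A₂ * balLike A m₂ + A₃ * balLike A m₃ +
      A₄ * balLike A m₄ + A₅ * balLike A m₅ + A₆ * balLike A m₆ = 0)
    (hne : (A₁ : ℝ) * γ ^ (m₁ - m₅) + (A₂ : ℝ) * γ ^ (m₂ - m₅) + (A₃ : ℝ) * γ ^ (m₃ - m₅) +
      (A₄ : ℝ) * γ ^ (m₄ - m₅) + (A₅ : ℝ) ≠ 0) :
    γ ^ m₅ < 8 * (X : ℝ) ∨
    (γ ^ (m₅ - m₆) ≤ 20 * (X : ℝ) ^ 2 ∧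
      ((m₅ - m₆ : ℕ) : ℝ) ≤ Real.log (20 * (X : ℝ) ^ 2) / Real.log ψ) := by
  have hAR : (3 : ℝ) ≤ A := mod_cast hA
  have hXR : (1 : ℝ) ≤ X := mod_cast hX
  obtain ⟨δ, hδ⟩ : ∃ δ : ℝ, δ = A - γ := ⟨_, rfl⟩
  have hsum : γ + δ = A := by rw [hδ]; ring
  have hmul : γ * δ = 1 := by
    have := Real.sq_sqrt (show (0 : ℝ) ≤ (A : ℝ) ^ 2 - 4 by nlinarith)
    rw [hδ, hγ]
    linear_combination -this / 4
  have hψγ : ψ ≤ γ := by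
    have : Real.sqrt 5 ≤ Real.sqrt ((A : ℝ) ^ 2 - 4) := Real.sqrt_le_sqrt (by nlinarith)
    rw [hγ, hψ]
    linarith
  have hψ1 : 1 < ψ := by
    rw [hψ]
    linarith [Real.sqrt_nonneg 5]
  have hγ1 : 1 < γ := hψ1.trans_le hψγ
  have hγ0 : 0 < γ := one_pos.trans hγ1
  have hδ0 : 0 < δ := pos_of_mul_pos_right (hmul ▸ one_pos) hγ0.le
  have hδ1 : δ ≤ 1 := by nlinarith
  have hδpow (n : ℕ) : 0 ≤ δ ^ n ∧ δ ^ n ≤ 1 :=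
    ⟨pow_nonneg hδ0.le n, pow_le_one₀ hδ0.le hδ1⟩
  have hpow (n : ℕ) : γ ^ n * δ ^ n = 1 := by rw [← mul_pow, hmul, one_pow]
  rw [or_iff_not_imp_left, not_lt]
  intro hlarge
  obtain ⟨S, hS⟩ : ∃ S, S = (A₁ : ℝ) * γ ^ (m₁ - m₅) + A₂ * γ ^ (m₂ - m₅) +
    A₃ * γ ^ (m₃ - m₅) + A₄ * γ ^ (m₄ - m₅) + A₅ := ⟨_, rfl⟩
  obtain ⟨T, hT⟩ : ∃ T, T = (A₁ : ℝ) * δ ^ (m₁ - m₅) + A₂ * δ ^ (m₂ - m₅) +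
    A₃ * δ ^ (m₃ - m₅) + A₄ * δ ^ (m₄ - m₅) + A₅ := ⟨_, rfl⟩
  rw [← hS] at hne
  have hnorm : 1 ≤ |S| * |T| := by
    obtain ⟨u₁, v₁, hu₁, hv₁⟩ := exists_pow_eq_add_mul A hsum hmul (m₁ - m₅)
    obtain ⟨u₂, v₂, hu₂, hv₂⟩ := exists_pow_eq_add_mul A hsum hmul (m₂ - m₅)
    obtain ⟨u₃, v₃, hu₃, hv₃⟩ := exists_pow_eq_add_mul A hsum hmul (m₃ - m₅)
    obtain ⟨u₄, v₄, hu₄, hv₄⟩ := exists_pow_eq_add_mul A hsum hmul (m₄ - m₅)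
    have hS' : S = ((A₁ * u₁ + A₂ * u₂ + A₃ * u₃ + A₄ * u₄ + A₅ : ℤ) : ℝ) +
        ((A₁ * v₁ + A₂ * v₂ + A₃ * v₃ + A₄ * v₄ : ℤ) : ℝ) * γ := by
      rw [hS, hu₁, hu₂, hu₃, hu₄]
      push_cast
      ring
    have hT' : T = ((A₁ * u₁ + A₂ * u₂ + A₃ * u₃ + A₄ * u₄ + A₅ : ℤ) : ℝ) +
        ((A₁ * v₁ + A₂ * v₂ + A₃ * v₃ + A₄ * v₄ : ℤ) : ℝ) * δ := by
      rw [hT, hv₁, hv₂, hv₃, hv₄]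
      push_cast
      ring
    rw [hS'] at hne
    rw [hS', hT']
    exact one_le_abs_mul_conj hA hsum hmul _ _ hne
  have hcast {a : ℤ} (ha : |a| ≤ X) : |(a : ℝ)| ≤ X := mod_cast ha
  have hterm {a : ℤ} (ha : |a| ≤ X) (n : ℕ) : |(a : ℝ) * δ ^ n| ≤ X :=
    abs_mul_le_of_abs_le_one (hcast ha) (hδpow n).1 (hδpow n).2
  have hTle : |T| ≤ 5 * X := by
    have b₁ := abs_le.1 (hterm h1 (m₁ - m₅))
    have b₂ := abs_le.1 (hterm h2 (m₂ - m₅))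
    have b₃ := abs_le.1 (hterm h3 (m₃ - m₅))
    have b₄ := abs_le.1 (hterm h4 (m₄ - m₅))
    have b₅ := abs_le.1 (hcast h5)
    rw [hT, abs_le]
    constructor <;> linarith
  have hsplit (t : ℝ) {m : ℕ} (h : m₅ ≤ m) : t ^ m = t ^ m₅ * t ^ (m - m₅) := by
    rw [← pow_add, Nat.add_sub_cancel' h]
  have hmain : γ ^ m₅ * S = δ ^ m₅ * T - A₆ * (γ ^ m₆ - δ ^ m₆) := by
    have hB := balLike_mul_sub A hsum hmul
    have e₁ := hB m₁
    have e₂ := hB m₂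
    have e₃ := hB m₃
    have e₄ := hB m₄
    rw [hsplit γ (by omega), hsplit δ (by omega)] at e₁ e₂ e₃ e₄
    have heqR : (A₁ : ℝ) * balLike A m₁ + A₂ * balLike A m₂ + A₃ * balLike A m₃ +
      A₄ * balLike A m₄ + A₅ * balLike A m₅ + A₆ * balLike A m₆ = 0 := mod_cast heq
    rw [hS, hT]
    linear_combination (γ - δ) * heqR - A₁ * e₁ - A₂ * e₂ - A₃ * e₃ - A₄ * e₄ -
      A₅ * hB m₅ - A₆ * hB m₆
  have hdiff : |(A₆ : ℝ) * (γ ^ m₆ - δ ^ m₆)| ≤ X * γ ^ m₆ := by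
    have : 1 ≤ γ ^ m₆ := one_le_pow₀ hγ1.le
    rw [abs_mul,
      abs_of_nonneg (a := γ ^ m₆ - δ ^ m₆) (by linarith [(hδpow m₆).2])]
    exact mul_le_mul (hcast h6) (by linarith [(hδpow m₆).1]) (by linarith [(hδpow m₆).2])
      (by linarith)
  have hSle : γ ^ m₅ * |S| ≤ δ ^ m₅ * |T| + X * γ ^ m₆ := by
    have := abs_sub (δ ^ m₅ * T) (A₆ * (γ ^ m₆ - δ ^ m₆))
    rw [← hmain, abs_mul, abs_mul, abs_of_pos (pow_pos hγ0 m₅), abs_of_nonneg (hδpow m₅).1] at this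
    linarith
  have hbound : γ ^ (m₅ - m₆) ≤ 20 * (X : ℝ) ^ 2 := by
    have hg5 : γ ^ m₅ = γ ^ m₆ * γ ^ (m₅ - m₆) := by
      rw [← pow_add, Nat.add_sub_cancel' h56]
    have hγ6 : 0 < γ ^ m₆ := pow_pos hγ0 m₆
    have hγ5 : 0 < γ ^ m₅ := pow_pos hγ0 m₅
    have hsmall : δ ^ m₅ * |T| ≤ 5 / 8 := by
      have : δ ^ m₅ * |T| ≤ δ ^ m₅ * (5 * X) := mul_le_mul_of_nonneg_left hTle (hδpow m₅).1
      nlinarith [mul_le_mul_of_nonneg_right hlarge (hδpow m₅).1, hpow m₅]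
    have hγ5le : γ ^ m₅ ≤ δ ^ m₅ * |T| * |T| + X * γ ^ m₆ * |T| := by
      nlinarith [mul_le_mul_of_nonneg_right hSle (abs_nonneg T),
        mul_le_mul_of_nonneg_left hnorm hγ5.le]
    have hfirst : δ ^ m₅ * |T| * |T| ≤ 25 / 64 * γ ^ m₅ := by
      have := mul_le_mul_of_nonneg_right hsmall (abs_nonneg T)
      linarith
    have hsecond : X * γ ^ m₆ * |T| ≤ γ ^ m₆ * (5 * (X : ℝ) ^ 2) := by
      have := mul_le_mul_of_nonneg_left hTle (show 0 ≤ X * γ ^ m₆ by positivity)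
      linarith
    refine le_of_mul_le_mul_left ?_ hγ6
    rw [← hg5]
    have : 0 ≤ γ ^ m₆ * (X : ℝ) ^ 2 := by positivity
    linarith
  refine ⟨hbound, ?_⟩
  rw [le_div_iff₀ (Real.log_pos hψ1), ← Real.log_pow]
  have hψ0 : 0 < ψ := one_pos.trans hψ1
  exact Real.log_le_log (pow_pos hψ0 _) ((pow_le_pow_left₀ hψ0.le hψγ _).trans hbound)
end

section
/- Let A ≥ 3 be an integer, γ = (A + √(A²−4))/2, ψ = (3 + √5)/2, and let A₁, …, A₆ be integers with A₁ ≠ 0 and |A_i| ≤ X for all i, X ≥ 1. Suppose A₁ x_{m₁} + A₂ x_{m₂} + A₃ x_{m₃} + A₄ x_{m₄} + A₅ x_{m₅} + A₆ x_{m₆} = 0 with m₁ > m₂ > m₃ ≥ m₄ ≥ m₅ ≥ m₆ ≥ 0, and suppose that none of the following vanishes: A₁γ^{m₁−m₃} + A₂γ^{m₂−m₃} + A₃; A₁γ^{m₁−m₄} + A₂γ^{m₂−m₄} + A₃γ^{m₃−m₄} + A₄; A₁γ^{m₁−m₅} + A₂γ^{m₂−m₅} + A₃γ^{m₃−m₅}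 + A₄γ^{m₄−m₅} + A₅; and A₁γ^{m₁−m₆} + A₂γ^{m₂−m₆} + A₃γ^{m₃−m₆} + A₄γ^{m₄−m₆} + A₅γ^{m₅−m₆} + A₆. Then the exponents are bounded: m₆ ≤ log(6X)/log ψ, m₅ ≤ log(120X³)/log ψ, m₄ ≤ log(3840X⁵)/log ψ, m₃ ≤ log(138240X⁷)/log ψ, m₂ ≤ log(8847360X⁹)/log ψ, and m₁ ≤ log(97320960X¹⁰)/log ψ. -/
/-- Binet's formula for the balancing-like sequence. -/
theorem sub_mul_balLike {A : ℤ} {γ δ : ℝ} (hsum : γ + δ = A) (hprod : γ * δ = 1) (n : ℕ) :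
    (γ - δ) * (balLike A n : ℝ) = γ ^ n - δ ^ n := by
  induction n using Nat.twoStepInduction with
  | zero => simp [balLike]
  | one => simp [balLike]
  | more n ih₀ ih₁ =>
    simp only [balLike]
    push_cast
    rw [← hsum]
    linear_combination (γ + δ) * ih₁ - ih₀ + (γ ^ n - δ ^ n) * hprod

/-- `u` and `v` are corresponding integer combinations `a + b γ` and `a + b δ`; when `γ` and `δ`
are conjugate quadratic integers, so are `u` and `v`. -/
def ConjPair (γ δ u v : ℝ) : Prop :=
  ∃ a b : ℤ, u = a + b * γ ∧ v = a + b * δ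

namespace ConjPair

variable {γ δ u v u' v' : ℝ}

theorem intCast (γ δ : ℝ) (c : ℤ) : ConjPair γ δ c c :=
  ⟨c, 0, by simp, by simp⟩

theorem add (h : ConjPair γ δ u v) (h' : ConjPair γ δ u' v') :
    ConjPair γ δ (u + u') (v + v') := by
  obtain ⟨a, b, rfl, rfl⟩ := h
  obtain ⟨c, d, rfl, rfl⟩ := h'
  exact ⟨a + c, b + d, by push_cast; ring, by push_cast; ring⟩

theorem swap (h : ConjPair γ δ u v) : ConjPair δ γ v u :=
  let ⟨a, b, hu, hv⟩ := h
  ⟨a, b, hv, hu⟩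

theorem intCast_mul (c : ℤ) (h : ConjPair γ δ u v) : ConjPair γ δ (c * u) (c * v) := by
  obtain ⟨a, b, rfl, rfl⟩ := h
  exact ⟨c * a, c * b, by push_cast; ring, by push_cast; ring⟩

theorem pow {A : ℤ} (hsum : γ + δ = A) (hprod : γ * δ = 1) (n : ℕ) :
    ConjPair γ δ (γ ^ n) (δ ^ n) := by
  induction n with
  | zero => exact ⟨1, 0, by simp, by simp⟩
  | succ n ih =>
    obtain ⟨a, b, hu, hv⟩ := ih
    refine ⟨-b, a + b * A, ?_, ?_⟩ <;> push_cast <;> rw [pow_succ, ← hsum]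
    · rw [hu]
      linear_combination (-(b : ℝ)) * hprod
    · rw [hv]
      linear_combination (-(b : ℝ)) * hprod

theorem monomial {A : ℤ} (hsum : γ + δ = A) (hprod : γ * δ = 1) (c : ℤ) (n : ℕ) :
    ConjPair γ δ (c * γ ^ n) (c * δ ^ n) :=
  (pow hsum hprod n).intCast_mul c

/-- The norm form of `X ^ 2 - A X + 1` is anisotropic for `A ≥ 3`. -/
theorem norm_ne_zero {A : ℤ} (hA : 3 ≤ A) {a b : ℤ} (hb : b ≠ 0) :
    a ^ 2 + a * b * A + b ^ 2 ≠ 0 := by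
  intro h
  have hsq : (2 * a + b * A) ^ 2 = b ^ 2 * (A ^ 2 - 4) := by linear_combination 4 * h
  obtain ⟨c, hc⟩ : b ∣ 2 * a + b * A :=
    (Int.pow_dvd_pow_iff two_ne_zero).1 ⟨_, hsq⟩
  have hcA : |c| ^ 2 = A ^ 2 - 4 := by
    rw [sq_abs]
    rw [hc, mul_pow] at hsq
    exact mul_left_cancel₀ (pow_ne_zero 2 hb) hsq
  have h₁ : |c| < A := by nlinarith [abs_nonneg c]
  have h₂ : A - 1 < |c| := by nlinarith [abs_nonneg c]
  omega

theorem one_le_abs_mul_abs {A : ℤ} (hA : 3 ≤ A) (hsum : γ + δ = A) (hprod : γ * δ = 1)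
    (h : ConjPair γ δ u v) (hu : u ≠ 0) : 1 ≤ |u| * |v| := by
  obtain ⟨a, b, hu', hv'⟩ := h
  have key : u * v = ((a ^ 2 + a * b * A + b ^ 2 : ℤ) : ℝ) := by
    rw [hu', hv']
    push_cast
    rw [← hsum]
    linear_combination (b : ℝ) ^ 2 * hprod
  have hne : a ^ 2 + a * b * A + b ^ 2 ≠ 0 := by
    by_cases hb : b = 0
    · subst hb
      have ha : a ≠ 0 := by
        rintro rfl
        simp at hu'
        exact hu hu'
      simpa using ha
    · exact norm_ne_zero hA hb
  rw [← abs_mul, key]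
  exact_mod_cast Int.one_le_abs hne

theorem le_mul_of_mul_eq {A : ℤ} (hA : 3 ≤ A) (hsum : γ + δ = A) (hprod : γ * δ = 1)
    (h : ConjPair γ δ u v) (hu : u ≠ 0) {C g R w : ℝ} (hv : |v| ≤ C) (hg : 0 ≤ g)
    (hgu : g * u = w) (hw : |w| ≤ R) : g ≤ C * R := by
  have h₁ : 1 ≤ |u| * C :=
    (one_le_abs_mul_abs hA hsum hprod h hu).trans (by gcongr)
  have h₂ : g * |u| = |w| := by rw [← hgu, abs_mul, abs_of_nonneg hg]
  have hC : 0 ≤ C := (abs_nonneg v).trans hv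
  calc g ≤ g * (|u| * C) := le_mul_of_one_le_right hg h₁
    _ = C * |w| := by rw [← h₂]; ring
    _ ≤ C * R := by gcongr

end ConjPair

theorem abs_mul_pow_le {c X δ : ℝ} (hc : |c| ≤ X) (h0 : 0 ≤ δ) (h1 : δ ≤ 1) (n : ℕ) :
    |c * δ ^ n| ≤ X := by
  rw [abs_mul, abs_of_nonneg (pow_nonneg h0 n)]
  exact (mul_le_of_le_one_right (abs_nonneg c) (pow_le_one₀ h0 h1)).trans hc

theorem le_log_div_log {γ ψ B : ℝ} {m : ℕ} (hψ : 1 < ψ) (hψγ : ψ ≤ γ) (h : γ ^ m ≤ B) :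
    (m : ℝ) ≤ Real.log B / Real.log ψ := by
  have hψ0 : 0 < ψ := by linarith
  rw [le_div_iff₀ (Real.log_pos hψ), ← Real.log_pow]
  exact Real.log_le_log (pow_pos hψ0 m) ((pow_le_pow_left₀ hψ0.le hψγ m).trans h)

theorem sporadic_bounds (A : ℤ) (hA : 3 ≤ A) (γ ψ : ℝ)
    (hγ : γ = ((A : ℝ) + Real.sqrt ((A : ℝ) ^ 2 - 4)) / 2)
    (hψ : ψ = (3 + Real.sqrt 5) / 2)
    (A₁ A₂ A₃ A₄ A₅ A₆ X : ℤ) (hA₁ : A₁ ≠ 0) (hX : 1 ≤ X)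
    (h1 : |A₁| ≤ X) (h2 : |A₂| ≤ X) (h3 : |A₃| ≤ X) (h4 : |A₄| ≤ X)
    (h5 : |A₅| ≤ X) (h6 : |A₆| ≤ X)
    (m₁ m₂ m₃ m₄ m₅ m₆ : ℕ) (h12 : m₁ > m₂) (h23 : m₂ > m₃) (h34 : m₃ ≥ m₄)
    (h45 : m₄ ≥ m₅) (h56 : m₅ ≥ m₆)
    (heq : A₁ * balLike A m₁ + A₂ * balLike A m₂ + A₃ * balLike A m₃ +
      A₄ * balLike A m₄ + A₅ * balLike A m₅ + A₆ * balLike A m₆ = 0)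
    (hne3 : (A₁ : ℝ) * γ ^ (m₁ - m₃) + (A₂ : ℝ) * γ ^ (m₂ - m₃) + (A₃ : ℝ) ≠ 0)
    (hne4 : (A₁ : ℝ) * γ ^ (m₁ - m₄) + (A₂ : ℝ) * γ ^ (m₂ - m₄) +
      (A₃ : ℝ) * γ ^ (m₃ - m₄) + (A₄ : ℝ) ≠ 0)
    (hne5 : (A₁ : ℝ) * γ ^ (m₁ - m₅) + (A₂ : ℝ) * γ ^ (m₂ - m₅) +
      (A₃ : ℝ) * γ ^ (m₃ - m₅) + (A₄ : ℝ) * γ ^ (m₄ - m₅) + (A₅ : ℝ) ≠ 0)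
    (hne6 : (A₁ : ℝ) * γ ^ (m₁ - m₆) + (A₂ : ℝ) * γ ^ (m₂ - m₆) +
      (A₃ : ℝ) * γ ^ (m₃ - m₆) + (A₄ : ℝ) * γ ^ (m₄ - m₆) +
      (A₅ : ℝ) * γ ^ (m₅ - m₆) + (A₆ : ℝ) ≠ 0) :
    (m₆ : ℝ) ≤ Real.log (6 * (X : ℝ)) / Real.log ψ ∧
    (m₅ : ℝ) ≤ Real.log (120 * (X : ℝ) ^ 3) / Real.log ψ ∧
    (m₄ : ℝ) ≤ Real.log (3840 * (X : ℝ) ^ 5) / Real.log ψ ∧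
    (m₃ : ℝ) ≤ Real.log (138240 * (X : ℝ) ^ 7) / Real.log ψ ∧
    (m₂ : ℝ) ≤ Real.log (8847360 * (X : ℝ) ^ 9) / Real.log ψ ∧
    (m₁ : ℝ) ≤ Real.log (97320960 * (X : ℝ) ^ 10) / Real.log ψ := by
  have hA' : (3 : ℝ) ≤ A := by exact_mod_cast hA
  have hX' : (1 : ℝ) ≤ X := by exact_mod_cast hX
  have hψ1 : 1 < ψ := by
    rw [hψ]
    linarith [Real.sqrt_nonneg 5]
  have hψγ : ψ ≤ γ := by
    rw [hψ, hγ]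
    have : Real.sqrt 5 ≤ Real.sqrt ((A : ℝ) ^ 2 - 4) := Real.sqrt_le_sqrt (by nlinarith)
    linarith
  have hγ1 : 1 < γ := hψ1.trans_le hψγ
  obtain ⟨δ, hδ⟩ : ∃ δ : ℝ, δ = A - γ := ⟨_, rfl⟩
  have hsum : γ + δ = A := by rw [hδ]; ring
  have hprod : γ * δ = 1 := by
    have := Real.sq_sqrt (show (0 : ℝ) ≤ (A : ℝ) ^ 2 - 4 by nlinarith)
    rw [hδ, hγ]
    linear_combination (-1 / 4 : ℝ) * this
  have hδ0 : 0 < δ := pos_of_mul_pos_right (by rw [hprod]; exact one_pos) (by linarith)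
  have hδ1 : δ < 1 := by nlinarith
  have a₁ : |(A₁ : ℝ)| ≤ X := by exact_mod_cast h1
  have a₂ : |(A₂ : ℝ)| ≤ X := by exact_mod_cast h2
  have a₃ : |(A₃ : ℝ)| ≤ X := by exact_mod_cast h3
  have a₄ : |(A₄ : ℝ)| ≤ X := by exact_mod_cast h4
  have a₅ : |(A₅ : ℝ)| ≤ X := by exact_mod_cast h5
  have a₆ : |(A₆ : ℝ)| ≤ X := by exact_mod_cast h6
  have hmono {m n : ℕ} (h : n ≤ m) : γ ^ n * γ ^ (m - n) = γ ^ m := by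
    rw [← pow_add, Nat.add_sub_cancel' h]
  have hmono' {m n : ℕ} (h : n ≤ m) : δ ^ n * δ ^ (m - n) = δ ^ m := by
    rw [← pow_add, Nat.add_sub_cancel' h]
  have hpos (n : ℕ) : 0 < γ ^ n := pow_pos (by linarith) n
  have hγm {c : ℤ} (hc : |(c : ℝ)| ≤ X) (n : ℕ) {B : ℝ} (hB : γ ^ n ≤ B) :
      |(c : ℝ) * γ ^ n| ≤ X * B := by
    rw [abs_mul, abs_of_pos (hpos n)]
    gcongr
  have hδm {c : ℤ} (hc : |(c : ℝ)| ≤ X) (n : ℕ) : |(c : ℝ) * δ ^ n| ≤ X :=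
    abs_mul_pow_le hc hδ0.le hδ1.le n
  have hmon := ConjPair.monomial hsum hprod
  have hpow {n k : ℕ} (h : n ≤ k) : (X : ℝ) ^ n ≤ X ^ k := pow_le_pow_right₀ hX' h
  have hT : A₁ * γ ^ m₁ + A₂ * γ ^ m₂ + A₃ * γ ^ m₃ + A₄ * γ ^ m₄ + A₅ * γ ^ m₅ + A₆ * γ ^ m₆ =
      A₁ * δ ^ m₁ + A₂ * δ ^ m₂ + A₃ * δ ^ m₃ + A₄ * δ ^ m₄ + A₅ * δ ^ m₅ + A₆ * δ ^ m₆ := by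
    have hb := sub_mul_balLike hsum hprod
    have heq' : (A₁ : ℝ) * balLike A m₁ + A₂ * balLike A m₂ + A₃ * balLike A m₃ +
        A₄ * balLike A m₄ + A₅ * balLike A m₅ + A₆ * balLike A m₆ = 0 := by
      exact_mod_cast heq
    linear_combination (γ - δ) * heq' - A₁ * hb m₁ - A₂ * hb m₂ - A₃ * hb m₃ -
      A₄ * hb m₄ - A₅ * hb m₅ - A₆ * hb m₆
  have hv₂ : |(A₁ : ℝ) * δ ^ (m₁ - m₂) + (A₂ : ℝ)| ≤ 2 * X := by
    obtain ⟨l₁, r₁⟩ := abs_le.1 (hδm a₁ (m₁ - m₂))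
    obtain ⟨l₂, r₂⟩ := abs_le.1 a₂
    exact abs_le.2 ⟨by linarith, by linarith⟩
  have hv₃ : |(A₁ : ℝ) * δ ^ (m₁ - m₃) + (A₂ : ℝ) * δ ^ (m₂ - m₃) + (A₃ : ℝ)| ≤ 3 * X := by
    obtain ⟨l₁, r₁⟩ := abs_le.1 (hδm a₁ (m₁ - m₃))
    obtain ⟨l₂, r₂⟩ := abs_le.1 (hδm a₂ (m₂ - m₃))
    obtain ⟨l₃, r₃⟩ := abs_le.1 a₃
    exact abs_le.2 ⟨by linarith, by linarith⟩
  have hv₄ : |(A₁ : ℝ) * δ ^ (m₁ - m₄) + (A₂ : ℝ) * δ ^ (m₂ - m₄) + (A₃ : ℝ) * δ ^ (m₃ - m₄) +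
      (A₄ : ℝ)| ≤ 4 * X := by
    obtain ⟨l₁, r₁⟩ := abs_le.1 (hδm a₁ (m₁ - m₄))
    obtain ⟨l₂, r₂⟩ := abs_le.1 (hδm a₂ (m₂ - m₄))
    obtain ⟨l₃, r₃⟩ := abs_le.1 (hδm a₃ (m₃ - m₄))
    obtain ⟨l₄, r₄⟩ := abs_le.1 a₄
    exact abs_le.2 ⟨by linarith, by linarith⟩
  have hv₅ : |(A₁ : ℝ) * δ ^ (m₁ - m₅) + (A₂ : ℝ) * δ ^ (m₂ - m₅) + (A₃ : ℝ) * δ ^ (m₃ - m₅) +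
      (A₄ : ℝ) * δ ^ (m₄ - m₅) + (A₅ : ℝ)| ≤ 5 * X := by
    obtain ⟨l₁, r₁⟩ := abs_le.1 (hδm a₁ (m₁ - m₅))
    obtain ⟨l₂, r₂⟩ := abs_le.1 (hδm a₂ (m₂ - m₅))
    obtain ⟨l₃, r₃⟩ := abs_le.1 (hδm a₃ (m₃ - m₅))
    obtain ⟨l₄, r₄⟩ := abs_le.1 (hδm a₄ (m₄ - m₅))
    obtain ⟨l₅, r₅⟩ := abs_le.1 a₅
    exact abs_le.2 ⟨by linarith, by linarith⟩
  have hv₆ : |(A₁ : ℝ) * δ ^ (m₁ - m₆) + (A₂ : ℝ) * δ ^ (m₂ - m₆) + (A₃ : ℝ) * δ ^ (m₃ - m₆) +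
      (A₄ : ℝ) * δ ^ (m₄ - m₆) + (A₅ : ℝ) * δ ^ (m₅ - m₆) + (A₆ : ℝ)| ≤ 6 * X := by
    obtain ⟨l₁, r₁⟩ := abs_le.1 (hδm a₁ (m₁ - m₆))
    obtain ⟨l₂, r₂⟩ := abs_le.1 (hδm a₂ (m₂ - m₆))
    obtain ⟨l₃, r₃⟩ := abs_le.1 (hδm a₃ (m₃ - m₆))
    obtain ⟨l₄, r₄⟩ := abs_le.1 (hδm a₄ (m₄ - m₆))
    obtain ⟨l₅, r₅⟩ := abs_le.1 (hδm a₅ (m₅ - m₆))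
    obtain ⟨l₆, r₆⟩ := abs_le.1 a₆
    exact abs_le.2 ⟨by linarith, by linarith⟩
  have hw : |A₁ * (δ : ℝ) ^ m₁ + A₂ * (δ : ℝ) ^ m₂ + A₃ * (δ : ℝ) ^ m₃ + A₄ * (δ : ℝ) ^ m₄ +
      A₅ * (δ : ℝ) ^ m₅ + A₆ * (δ : ℝ) ^ m₆| ≤ 6 * X := by
    obtain ⟨l₁, r₁⟩ := abs_le.1 (hδm a₁ m₁)
    obtain ⟨l₂, r₂⟩ := abs_le.1 (hδm a₂ m₂)
    obtain ⟨l₃, r₃⟩ := abs_le.1 (hδm a₃ m₃)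
    obtain ⟨l₄, r₄⟩ := abs_le.1 (hδm a₄ m₄)
    obtain ⟨l₅, r₅⟩ := abs_le.1 (hδm a₅ m₅)
    obtain ⟨l₆, r₆⟩ := abs_le.1 (hδm a₆ m₆)
    exact abs_le.2 ⟨by linarith, by linarith⟩
  have b₆ : γ ^ m₆ ≤ 6 * X := by
    have hpd : γ ^ m₆ * δ ^ m₆ = 1 := by rw [← mul_pow, hprod, one_pow]
    have hu := ((((((hmon A₁ (m₁ - m₆)).add (hmon A₂ (m₂ - m₆))).add (hmon A₃ (m₃ - m₆))).add
        (hmon A₄ (m₄ - m₆))).add (hmon A₅ (m₅ - m₆))).add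
        (.intCast γ δ A₆)).le_mul_of_mul_eq hA hsum hprod hne6 hv₆
      (sq_nonneg (γ ^ m₆)) (w := (A₁ : ℝ) * δ ^ (m₁ - m₆) + (A₂ : ℝ) * δ ^ (m₂ - m₆) +
          (A₃ : ℝ) * δ ^ (m₃ - m₆) + (A₄ : ℝ) * δ ^ (m₄ - m₆) + (A₅ : ℝ) * δ ^ (m₅ - m₆) +
          (A₆ : ℝ)) ?_ hv₆
    · exact le_of_sq_le_sq (by linarith) (by linarith)
    · have e₁ : γ ^ m₆ * ((A₁ : ℝ) * γ ^ (m₁ - m₆) + (A₂ : ℝ) * γ ^ (m₂ - m₆) +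
        (A₃ : ℝ) * γ ^ (m₃ - m₆) + (A₄ : ℝ) * γ ^ (m₄ - m₆) + (A₅ : ℝ) * γ ^ (m₅ - m₆) +
        (A₆ : ℝ)) = A₁ * γ ^ m₁ + A₂ * γ ^ m₂ + A₃ * γ ^ m₃ + A₄ * γ ^ m₄ + A₅ * γ ^ m₅ +
        A₆ * γ ^ m₆ := by
        linear_combination A₁ * hmono (show m₆ ≤ m₁ by omega) +
            A₂ * hmono (show m₆ ≤ m₂ by omega) + A₃ * hmono (show m₆ ≤ m₃ by omega) +
            A₄ * hmono (show m₆ ≤ m₄ by omega) + A₅ * hmono (show m₆ ≤ m₅ by omega)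
      have e₂ : δ ^ m₆ * ((A₁ : ℝ) * δ ^ (m₁ - m₆) + (A₂ : ℝ) * δ ^ (m₂ - m₆) +
          (A₃ : ℝ) * δ ^ (m₃ - m₆) + (A₄ : ℝ) * δ ^ (m₄ - m₆) + (A₅ : ℝ) * δ ^ (m₅ - m₆) +
          (A₆ : ℝ)) = A₁ * δ ^ m₁ + A₂ * δ ^ m₂ + A₃ * δ ^ m₃ + A₄ * δ ^ m₄ + A₅ * δ ^ m₅ +
          A₆ * δ ^ m₆ := by
        linear_combination A₁ * hmono' (show m₆ ≤ m₁ by omega) +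
            A₂ * hmono' (show m₆ ≤ m₂ by omega) + A₃ * hmono' (show m₆ ≤ m₃ by omega) +
            A₄ * hmono' (show m₆ ≤ m₄ by omega) + A₅ * hmono' (show m₆ ≤ m₅ by omega)
      linear_combination γ ^ m₆ * e₁ + γ ^ m₆ * hT - γ ^ m₆ * e₂ + ((A₁ : ℝ) * δ ^ (m₁ - m₆) +
          (A₂ : ℝ) * δ ^ (m₂ - m₆) + (A₃ : ℝ) * δ ^ (m₃ - m₆) + (A₄ : ℝ) * δ ^ (m₄ - m₆) +
          (A₅ : ℝ) * δ ^ (m₅ - m₆) + (A₆ : ℝ)) * hpd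
  have hne2 : (A₁ : ℝ) * γ ^ (m₁ - m₂) + (A₂ : ℝ) ≠ 0 := by
    have hp : δ ^ (m₁ - m₂) < 1 := pow_lt_one₀ hδ0.le hδ1 (by omega)
    have hp' : 1 < γ ^ (m₁ - m₂) := one_lt_pow₀ hγ1 (by omega)
    intro h
    have hconj : (A₁ : ℝ) * δ ^ (m₁ - m₂) + (A₂ : ℝ) = 0 := by
      by_contra hne
      have := ((hmon A₁ (m₁ - m₂)).add (.intCast γ δ A₂)).swap.one_le_abs_mul_abs hA
        (by rw [add_comm, hsum]) (by rw [mul_comm, hprod]) hne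
      rw [h, abs_zero, mul_zero] at this
      linarith
    have hA₁' : (A₁ : ℝ) ≠ 0 := by exact_mod_cast hA₁
    have := mul_left_cancel₀ hA₁' (add_right_cancel (h.trans hconj.symm))
    linarith
  have b₅ : γ ^ m₅ ≤ 60 * X ^ 3 := by
    have hR : |(A₁ * δ ^ m₁ + A₂ * δ ^ m₂ + A₃ * δ ^ m₃ + A₄ * δ ^ m₄ + A₅ * δ ^ m₅ +
        A₆ * δ ^ m₆) - A₆ * γ ^ m₆| ≤ 6 * X + X * (6 * X) := by
      obtain ⟨l₀, r₀⟩ := abs_le.1 hw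
      obtain ⟨l₆, r₆⟩ := abs_le.1 (hγm a₆ m₆ b₆)
      exact abs_le.2 ⟨by linarith, by linarith⟩
    have hR' : 6 * (X : ℝ) + X * (6 * X) ≤ 12 * X ^ 2 := by
      linarith [hpow (show 1 ≤ 2 by norm_num)]
    have := (((((hmon A₁ (m₁ - m₅)).add (hmon A₂ (m₂ - m₅))).add (hmon A₃ (m₃ - m₅))).add
        (hmon A₄ (m₄ - m₅))).add (.intCast γ δ A₅)).le_mul_of_mul_eq hA hsum hprod hne5 hv₅
      (hpos m₅).le ?_ (hR.trans hR')
    · linarith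
    · linear_combination hT + A₁ * hmono (show m₅ ≤ m₁ by omega) +
        A₂ * hmono (show m₅ ≤ m₂ by omega) + A₃ * hmono (show m₅ ≤ m₃ by omega) +
        A₄ * hmono (show m₅ ≤ m₄ by omega)
  have b₄ : γ ^ m₄ ≤ 288 * X ^ 5 := by
    have hR : |(A₁ * δ ^ m₁ + A₂ * δ ^ m₂ + A₃ * δ ^ m₃ + A₄ * δ ^ m₄ + A₅ * δ ^ m₅ +
        A₆ * δ ^ m₆) - A₅ * γ ^ m₅ - A₆ * γ ^ m₆| ≤ 6 * X + X * (60 * X ^ 3) + X * (6 * X) := by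
      obtain ⟨l₀, r₀⟩ := abs_le.1 hw
      obtain ⟨l₅, r₅⟩ := abs_le.1 (hγm a₅ m₅ b₅)
      obtain ⟨l₆, r₆⟩ := abs_le.1 (hγm a₆ m₆ b₆)
      exact abs_le.2 ⟨by linarith, by linarith⟩
    have hR' : 6 * (X : ℝ) + X * (60 * X ^ 3) + X * (6 * X) ≤ 72 * X ^ 4 := by
      linarith [hpow (show 1 ≤ 4 by norm_num), hpow (show 2 ≤ 4 by norm_num)]
    have := ((((hmon A₁ (m₁ - m₄)).add (hmon A₂ (m₂ - m₄))).add (hmon A₃ (m₃ - m₄))).add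
        (.intCast γ δ A₄)).le_mul_of_mul_eq hA hsum hprod hne4 hv₄
      (hpos m₄).le ?_ (hR.trans hR')
    · linarith
    · linear_combination hT + A₁ * hmono (show m₄ ≤ m₁ by omega) +
        A₂ * hmono (show m₄ ≤ m₂ by omega) + A₃ * hmono (show m₄ ≤ m₃ by omega)
  have b₃ : γ ^ m₃ ≤ 1080 * X ^ 7 := by
    have hR : |(A₁ * δ ^ m₁ + A₂ * δ ^ m₂ + A₃ * δ ^ m₃ + A₄ * δ ^ m₄ + A₅ * δ ^ m₅ +
        A₆ * δ ^ m₆) - A₄ * γ ^ m₄ - A₅ * γ ^ m₅ - A₆ * γ ^ m₆| ≤ 6 * X + X * (288 * X ^ 5) +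
        X * (60 * X ^ 3) + X * (6 * X) := by
      obtain ⟨l₀, r₀⟩ := abs_le.1 hw
      obtain ⟨l₄, r₄⟩ := abs_le.1 (hγm a₄ m₄ b₄)
      obtain ⟨l₅, r₅⟩ := abs_le.1 (hγm a₅ m₅ b₅)
      obtain ⟨l₆, r₆⟩ := abs_le.1 (hγm a₆ m₆ b₆)
      exact abs_le.2 ⟨by linarith, by linarith⟩
    have hR' : 6 * (X : ℝ) + X * (288 * X ^ 5) + X * (60 * X ^ 3) + X * (6 * X) ≤ 360 * X ^ 6 := by
      linarith [hpow (show 1 ≤ 6 by norm_num), hpow (show 2 ≤ 6 by norm_num),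
          hpow (show 4 ≤ 6 by norm_num)]
    have := (((hmon A₁ (m₁ - m₃)).add (hmon A₂ (m₂ - m₃))).add
        (.intCast γ δ A₃)).le_mul_of_mul_eq hA hsum hprod hne3 hv₃
      (hpos m₃).le ?_ (hR.trans hR')
    · linarith
    · linear_combination hT + A₁ * hmono (show m₃ ≤ m₁ by omega) +
        A₂ * hmono (show m₃ ≤ m₂ by omega)
  have b₂ : γ ^ m₂ ≤ 2880 * X ^ 9 := by
    have hR : |(A₁ * δ ^ m₁ + A₂ * δ ^ m₂ + A₃ * δ ^ m₃ + A₄ * δ ^ m₄ + A₅ * δ ^ m₅ +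
        A₆ * δ ^ m₆) - A₃ * γ ^ m₃ - A₄ * γ ^ m₄ - A₅ * γ ^ m₅ - A₆ * γ ^ m₆| ≤ 6 * X +
        X * (1080 * X ^ 7) + X * (288 * X ^ 5) + X * (60 * X ^ 3) + X * (6 * X) := by
      obtain ⟨l₀, r₀⟩ := abs_le.1 hw
      obtain ⟨l₃, r₃⟩ := abs_le.1 (hγm a₃ m₃ b₃)
      obtain ⟨l₄, r₄⟩ := abs_le.1 (hγm a₄ m₄ b₄)
      obtain ⟨l₅, r₅⟩ := abs_le.1 (hγm a₅ m₅ b₅)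
      obtain ⟨l₆, r₆⟩ := abs_le.1 (hγm a₆ m₆ b₆)
      exact abs_le.2 ⟨by linarith, by linarith⟩
    have hR' : 6 * (X : ℝ) + X * (1080 * X ^ 7) + X * (288 * X ^ 5) + X * (60 * X ^ 3) +
        X * (6 * X) ≤ 1440 * X ^ 8 := by
      linarith [hpow (show 1 ≤ 8 by norm_num), hpow (show 2 ≤ 8 by norm_num),
          hpow (show 4 ≤ 8 by norm_num), hpow (show 6 ≤ 8 by norm_num)]
    have := ((hmon A₁ (m₁ - m₂)).add (.intCast γ δ A₂)).le_mul_of_mul_eq hA hsum hprod hne2 hv₂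
      (hpos m₂).le ?_ (hR.trans hR')
    · linarith
    · linear_combination hT + A₁ * hmono (show m₂ ≤ m₁ by omega)
  have b₁ : γ ^ m₁ ≤ 4320 * X ^ 10 := by
    have hR : |(A₁ * δ ^ m₁ + A₂ * δ ^ m₂ + A₃ * δ ^ m₃ + A₄ * δ ^ m₄ + A₅ * δ ^ m₅ +
        A₆ * δ ^ m₆) - A₂ * γ ^ m₂ - A₃ * γ ^ m₃ - A₄ * γ ^ m₄ - A₅ * γ ^ m₅ - A₆ * γ ^ m₆| ≤
        6 * X + X * (2880 * X ^ 9) + X * (1080 * X ^ 7) + X * (288 * X ^ 5) + X * (60 * X ^ 3) +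
        X * (6 * X) := by
      obtain ⟨l₀, r₀⟩ := abs_le.1 hw
      obtain ⟨l₂, r₂⟩ := abs_le.1 (hγm a₂ m₂ b₂)
      obtain ⟨l₃, r₃⟩ := abs_le.1 (hγm a₃ m₃ b₃)
      obtain ⟨l₄, r₄⟩ := abs_le.1 (hγm a₄ m₄ b₄)
      obtain ⟨l₅, r₅⟩ := abs_le.1 (hγm a₅ m₅ b₅)
      obtain ⟨l₆, r₆⟩ := abs_le.1 (hγm a₆ m₆ b₆)
      exact abs_le.2 ⟨by linarith, by linarith⟩
    have hA₁' : (1 : ℝ) ≤ |(A₁ : ℝ)| := by exact_mod_cast Int.one_le_abs hA₁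
    have hw₁ : |(A₁ : ℝ)| * γ ^ m₁ = |(A₁ * δ ^ m₁ + A₂ * δ ^ m₂ + A₃ * δ ^ m₃ + A₄ * δ ^ m₄ +
        A₅ * δ ^ m₅ +
        A₆ * δ ^ m₆) - A₂ * γ ^ m₂ - A₃ * γ ^ m₃ - A₄ * γ ^ m₄ - A₅ * γ ^ m₅ - A₆ * γ ^ m₆| := by
      rw [← abs_of_pos (hpos m₁), ← abs_mul]
      congr 1
      linear_combination hT
    have hle : γ ^ m₁ ≤ |(A₁ : ℝ)| * γ ^ m₁ := le_mul_of_one_le_left (hpos m₁).le hA₁'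
    linarith [hpow (show 1 ≤ 10 by norm_num), hpow (show 2 ≤ 10 by norm_num),
        hpow (show 4 ≤ 10 by norm_num), hpow (show 6 ≤ 10 by norm_num),
        hpow (show 8 ≤ 10 by norm_num)]
  exact ⟨le_log_div_log hψ1 hψγ b₆,
    le_log_div_log hψ1 hψγ (b₅.trans (by gcongr; norm_num)),
    le_log_div_log hψ1 hψγ (b₄.trans (by gcongr; norm_num)),
    le_log_div_log hψ1 hψγ (b₃.trans (by gcongr; norm_num)),
    le_log_div_log hψ1 hψγ (b₂.trans (by gcongr; norm_num)),
    le_log_div_log hψ1 hψγ (b₁.trans (by gcongr; norm_num))⟩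
end
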